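/- arXiv:1211.4066 — 3 statements merged into one kernel-verified Lean document; each statement's English description precedes it below -/
import Mathlib

section
/- (Continuous-time case of Theorem 4.2: uniqueness under a left-handed matrix Lipschitz condition.) Let n ≥ 1, let a ≤ b be real numbers, let S be a set of symmetric real n×n matrices, and let F : ℝ → Matrix n n ℝ → Matrix n n ℝ be such that F(t,P) is symmetric for every t ∈ [a,b] and every P ∈ S. Let B : ℝ → Matrix n n ℝ be continuous on [a,b] with B(t) symmetric positive definite for every t ∈ [a,b], and assume the commutation conditions: B(s)·B(t) = B(t)·B(s) for all s,t ∈ [a,b]; B(s)·P = P·B(s) for all s ∈ [a,b] and P ∈ S; and B(s)·F(t,Q) = F(t,Q)·B(s) for all s,t ∈ [a,b] and Q ∈ S. Assume the left-handed Lipschitz condition: for all t ∈ [a,b] and all P, Q ∈ S with P − Q positive semidefinite, the matrix B(t)·(P − Q) − (F(t,P) − F(t,Q)) is positive semidefinite. Then if X, Y : ℝ → Matrix n n ℝ are differentiable on [a,b] with X′(t) = F(t, X(t)) and Y′(t) = F(t, Y(t)) for all t ∈ [a,b], X(t) ∈ S and Y(t) ∈ S and X(t) − Y(t) positive semidefinite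 for all t ∈ [a,b], and X(a) = Y(a), then X(t) = Y(t) for all t ∈ [a,b]. -/
open Matrix Set

lemma aux_entry {n : ℕ} {D : Matrix (Fin n) (Fin n) ℝ} (hD : D.PosSemidef) (i j : Fin n) :
    |D i j| ≤ D.trace := by
  have hd : ∀ k, D k k ≤ D.trace := fun k =>
    Finset.single_le_sum (f := fun k => D k k) (fun l _ => hD.diag_nonneg) (Finset.mem_univ k)
  have hs : D j i = D i j := by simpa using hD.1.apply i j
  have h1 := hD.dotProduct_mulVec_nonneg (Pi.single i 1 + Pi.single j 1)
  have h2 := hD.dotProduct_mulVec_nonneg (Pi.single i 1 - Pi.single j 1)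
  simp [Matrix.mulVec_add, Matrix.mulVec_sub, add_dotProduct, sub_dotProduct] at h1 h2
  have := hd i
  have := hd j
  rw [abs_le]
  constructor <;> linarith

/-- Continuous-time case of Theorem 4.2: uniqueness for `X' = F(t, X)` under a
left-handed matrix Lipschitz condition with positive definite Lipschitz "constant" `B`. -/
theorem stmt_0 (n : ℕ) (hn : 1 ≤ n) (a b : ℝ) (hab : a ≤ b)
    (S : Set (Matrix (Fin n) (Fin n) ℝ))
    (hS : ∀ P ∈ S, P.IsSymm)
    (F : ℝ → Matrix (Fin n) (Fin n) ℝ → Matrix (Fin n) (Fin n) ℝ)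
    (hFsymm : ∀ t ∈ Icc a b, ∀ P ∈ S, (F t P).IsSymm)
    (B : ℝ → Matrix (Fin n) (Fin n) ℝ)
    (hBcont : ContinuousOn B (Icc a b))
    (hBpd : ∀ t ∈ Icc a b, (B t).PosDef)
    (hBB : ∀ s ∈ Icc a b, ∀ t ∈ Icc a b, B s * B t = B t * B s)
    (hBS : ∀ s ∈ Icc a b, ∀ P ∈ S, B s * P = P * B s)
    (hBF : ∀ s ∈ Icc a b, ∀ t ∈ Icc a b, ∀ Q ∈ S, B s * F t Q = F t Q * B s)
    (hLip : ∀ t ∈ Icc a b, ∀ P ∈ S, ∀ Q ∈ S, (P - Q).PosSemidef →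
      (B t * (P - Q) - (F t P - F t Q)).PosSemidef)
    (X Y : ℝ → Matrix (Fin n) (Fin n) ℝ)
    (hX : ∀ t ∈ Icc a b, ∀ i j, HasDerivAt (fun s => X s i j) (F t (X t) i j) t)
    (hY : ∀ t ∈ Icc a b, ∀ i j, HasDerivAt (fun s => Y s i j) (F t (Y t) i j) t)
    (hXS : ∀ t ∈ Icc a b, X t ∈ S)
    (hYS : ∀ t ∈ Icc a b, Y t ∈ S)
    (hXY : ∀ t ∈ Icc a b, (X t - Y t).PosSemidef)
    (hinit : X a = Y a) :
    ∀ t ∈ Icc a b, X t = Y t := by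
  have hc : ContinuousOn (fun t => ∑ i, ∑ j, |B t i j|) (Icc a b) := by
    refine continuousOn_finsetSum _ fun i _ => continuousOn_finsetSum _ fun j _ => ?_
    exact ((continuous_id.matrix_elem i j).comp_continuousOn hBcont).abs
  obtain ⟨C, hC⟩ := (isCompact_Icc.bddAbove_image hc)
  have hC' : ∀ t ∈ Icc a b, ∑ i, ∑ j, |B t i j| ≤ C := fun t ht => hC ⟨t, ht, rfl⟩
  have htr : ∀ t ∈ Icc a b, (F t (X t) - F t (Y t)).trace ≤ C * (X t - Y t).trace := by
    intro t ht
    have h1 := (hLip t ht _ (hXS t ht) _ (hYS t ht) (hXY t ht)).trace_nonneg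
    rw [Matrix.trace_sub] at h1
    have h2 : (B t * (X t - Y t)).trace ≤ (∑ i, ∑ j, |B t i j|) * (X t - Y t).trace := by
      rw [Finset.sum_mul]
      refine Finset.sum_le_sum fun i _ => ?_
      rw [Finset.sum_mul, Matrix.diag_apply, Matrix.mul_apply]
      refine Finset.sum_le_sum fun j _ => ?_
      refine (le_abs_self _).trans ?_
      rw [abs_mul]
      exact mul_le_mul_of_nonneg_left (aux_entry (hXY t ht) j i) (abs_nonneg _)
    have h3 := mul_le_mul_of_nonneg_right (hC' t ht) (hXY t ht).trace_nonneg
    linarith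
  have hder : ∀ t ∈ Icc a b, HasDerivAt (fun s => (X s - Y s).trace)
      ((F t (X t) - F t (Y t)).trace) t := by
    intro t ht
    exact HasDerivAt.fun_sum fun i _ => (hX t ht i i).sub (hY t ht i i)
  have hg : ∀ t ∈ Icc a b, HasDerivAt (fun s => (X s - Y s).trace * Real.exp (-C * s))
      ((F t (X t) - F t (Y t)).trace * Real.exp (-C * t)
        + (X t - Y t).trace * (Real.exp (-C * t) * (-C * 1))) t := fun t ht =>
    (hder t ht).mul (((hasDerivAt_id t).const_mul (-C)).exp)
  have hanti : AntitoneOn (fun s => (X s - Y s).trace * Real.exp (-C * s)) (Icc a b) := by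
    refine antitoneOn_of_hasDerivWithinAt_nonpos (convex_Icc a b)
      (fun t ht => (hg t ht).continuousAt.continuousWithinAt)
      (fun t ht => (hg t (interior_subset ht)).hasDerivWithinAt) ?_
    intro t ht
    have := mul_le_mul_of_nonneg_right (htr t (interior_subset ht)) (Real.exp_pos (-C * t)).le
    linarith
  intro t ht
  have h := hanti (left_mem_Icc.2 hab) ht ht.1
  simp only [hinit, sub_self, Matrix.trace_zero, zero_mul] at h
  have h0 : (X t - Y t).trace ≤ 0 := nonpos_of_mul_nonpos_left h (Real.exp_pos _)
  ext i j
  have h1 := (aux_entry (hXY t ht) i j).trans h0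
  exact sub_eq_zero.1 (abs_nonpos_iff.1 h1)
end

section
/- (Discrete case T = ℤ of Theorem 4.10: uniqueness for the implicit difference equation X(t+1) − X(t) = F(t, X(t+1)).) Let n ≥ 1, let a ≤ b be natural numbers, let S be a set of symmetric real n×n matrices, and let F : ℕ → Matrix n n ℝ → Matrix n n ℝ be such that F(t,P) is symmetric for every t and every P ∈ S. Let B : ℕ → Matrix n n ℝ be such that B(t) is symmetric positive definite for every t with a ≤ t < b, B(s)·B(t) = B(t)·B(s) for all such s,t, and B(t)·P = P·B(t) for all such t and all P ∈ S. Assume: for all t with a ≤ t < b and all P, Q ∈ S with P − Q positive semidefinite, the matrix (I + B(t))⁻¹·B(t)·(P − Q) − (F(t,P) − F(t,Q)) is positive semidefinite (note I + B(t) is invertible since B(t) is positive definite). Then if X, Y : ℕ → Matrix n n ℝ satisfy X(t+1) − X(t) = F(t, X(t+1)) and Y(t+1) − Y(t) = F(t, Y(t+1)) for all a ≤ t < b, with X(t) ∈ S, Y(t) ∈ S and X(t) − Y(t) positive semidefinite for all a ≤ t ≤ b, and X(a) = Y(a), then X(t) = Y(t) for all a ≤ t ≤ b. -/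
open Matrix
open scoped MatrixOrder

theorem aux_step {n : ℕ} (B D : Matrix (Fin n) (Fin n) ℝ) (hB : B.PosDef) (hD : D.PosSemidef)
    (h : ((1 + B)⁻¹ * B * D - D).PosSemidef) : D = 0 := by
  have hA : (1 + B).PosDef := Matrix.PosDef.one.add hB
  have hdet : IsUnit (1 + B).det := (Matrix.isUnit_iff_isUnit_det _).1 hA.isUnit
  set M := (1 + B)⁻¹ * B * D - D with hM
  have e : (1 + B) * M = -D := by
    rw [hM, mul_sub, ← mul_assoc, ← mul_assoc, Matrix.mul_nonsing_inv _ hdet]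
    noncomm_ring
  have h1 : 0 ≤ (B * M).trace := by
    obtain ⟨C, hC⟩ : ∃ C : Matrix (Fin n) (Fin n) ℝ, B = Cᴴ * C :=
      CStarAlgebra.nonneg_iff_eq_star_mul_self.mp hB.posSemidef.nonneg
    have := (h.mul_mul_conjTranspose_same C).trace_nonneg
    rw [hC, mul_assoc, Matrix.trace_mul_comm]
    exact this
  have h2 := h.trace_nonneg
  have h3 := hD.trace_nonneg
  have h4 := congrArg Matrix.trace e
  rw [add_mul, one_mul, Matrix.trace_add, Matrix.trace_neg] at h4
  exact hD.trace_eq_zero_iff.1 (by linarith)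

/-- Discrete case `T = ℤ` of Theorem 4.10: uniqueness for the implicit difference
equation `X(t+1) - X(t) = F(t, X(t+1))` under the modified left-handed Lipschitz
condition with bound `(I + B(t))⁻¹ * B(t)`. -/
theorem stmt_2 (n : ℕ) (hn : 1 ≤ n) (a b : ℕ) (hab : a ≤ b)
    (S : Set (Matrix (Fin n) (Fin n) ℝ))
    (hS : ∀ P ∈ S, P.IsSymm)
    (F : ℕ → Matrix (Fin n) (Fin n) ℝ → Matrix (Fin n) (Fin n) ℝ)
    (hFsymm : ∀ t, ∀ P ∈ S, (F t P).IsSymm)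
    (B : ℕ → Matrix (Fin n) (Fin n) ℝ)
    (hBpd : ∀ t, a ≤ t → t < b → (B t).PosDef)
    (hBB : ∀ s t, a ≤ s → s < b → a ≤ t → t < b → B s * B t = B t * B s)
    (hBS : ∀ t, a ≤ t → t < b → ∀ P ∈ S, B t * P = P * B t)
    (hLip : ∀ t, a ≤ t → t < b → ∀ P ∈ S, ∀ Q ∈ S, (P - Q).PosSemidef →
      ((1 + B t)⁻¹ * B t * (P - Q) - (F t P - F t Q)).PosSemidef)
    (X Y : ℕ → Matrix (Fin n) (Fin n) ℝ)
    (hX : ∀ t, a ≤ t → t < b → X (t + 1) - X t = F t (X (t + 1)))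
    (hY : ∀ t, a ≤ t → t < b → Y (t + 1) - Y t = F t (Y (t + 1)))
    (hXS : ∀ t, a ≤ t → t ≤ b → X t ∈ S)
    (hYS : ∀ t, a ≤ t → t ≤ b → Y t ∈ S)
    (hXY : ∀ t, a ≤ t → t ≤ b → (X t - Y t).PosSemidef)
    (hinit : X a = Y a) :
    ∀ t, a ≤ t → t ≤ b → X t = Y t := by
  intro t hat
  induction t, hat using Nat.le_induction with
  | base => intro _; exact hinit
  | succ t hat ih =>
    intro htb
    have htb' : t < b := htb
    have e := ih htb'.le
    have hL := hLip t hat htb' _ (hXS (t+1) (by omega) htb) _ (hYS (t+1) (by omega) htb)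
      (hXY (t+1) (by omega) htb)
    rw [← hX t hat htb', ← hY t hat htb', e, sub_sub_sub_cancel_right] at hL
    exact sub_eq_zero.1 (aux_step _ _ (hBpd t hat htb') (hXY (t+1) (by omega) htb) hL)
end

section
/- (Continuous-time case of Corollary 4.6: uniqueness under an inverse Lipschitz condition.) Let n ≥ 1, let a ≤ b be real numbers, let S be a set of symmetric real n×n matrices, and let F : ℝ → Matrix n n ℝ → Matrix n n ℝ be such that F(t,P) is symmetric for every t ∈ [a,b] and every P ∈ S. Let B : ℝ → Matrix n n ℝ be continuous on [a,b] with B(t) symmetric positive definite for every t ∈ [a,b], and assume the commutation conditions: B(s)·B(t) = B(t)·B(s) for all s,t ∈ [a,b]; B(s)·P = P·B(s) for all s ∈ [a,b] and P ∈ S; and B(s)·F(t,Q) = F(t,Q)·B(s) for all s,t ∈ [a,b] and Q ∈ S. Assume the inverse Lipschitz condition: for all t ∈ [a,b] and all P, Q ∈ S with P − Q positive semidefinite, either P = Q, or else P − Q is positive definite, F(t,P) − F(t,Q) is positive definite, (F(t,P) − F(t,Q))·(P − Q) = (P − Q)·(F(t,P) − F(t,Q)), and (F(t,P) − F(t,Q))⁻¹·B(t)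 − (P − Q)⁻¹ is positive semidefinite. Then if X, Y : ℝ → Matrix n n ℝ are differentiable on [a,b] with X′(t) = F(t, X(t)) and Y′(t) = F(t, Y(t)) for all t ∈ [a,b], X(t) ∈ S and Y(t) ∈ S and X(t) − Y(t) positive semidefinite for all t ∈ [a,b], and X(a) = Y(a), then X(t) = Y(t) for all t ∈ [a,b]. -/
open Matrix Set

lemma aux_comm_psd {n : ℕ} {A D : Matrix (Fin n) (Fin n) ℝ} (hA : A.PosSemidef)
    (hD : D.PosSemidef) (h : A * D = D * A) : (A * D).PosSemidef := by
  open scoped MatrixOrder in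
  rw [← Matrix.nonneg_iff_posSemidef] at *
  exact Commute.mul_nonneg hA hD h

lemma aux_diag_le {n : ℕ} {D : Matrix (Fin n) (Fin n) ℝ} (hD : D.PosSemidef) (i : Fin n) :
    D i i ≤ D.trace := by
  exact Finset.single_le_sum (f := fun i => D i i) (fun i _ => hD.diag_nonneg) (Finset.mem_univ i)

lemma aux_trace_mul {n : ℕ} (B : Matrix (Fin n) (Fin n) ℝ) {D : Matrix (Fin n) (Fin n) ℝ}
    (hD : D.PosSemidef) : (B * D).trace ≤ (∑ i, ∑ j, |B i j|) * D.trace := by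
  simp only [Matrix.trace, Matrix.diag, Matrix.mul_apply, Finset.sum_mul]
  refine Finset.sum_le_sum fun i _ => Finset.sum_le_sum fun j _ => ?_
  calc B i j * D j i ≤ |B i j * D j i| := le_abs_self _
    _ = |B i j| * |D j i| := abs_mul _ _
    _ ≤ _ := mul_le_mul_of_nonneg_left (aux_entry hD j i) (abs_nonneg _)

lemma aux_key {n : ℕ} {G D B : Matrix (Fin n) (Fin n) ℝ} (hD : D.PosDef) (hG : G.PosDef)
    (hGD : G * D = D * G) (hBD : B * D = D * B) (hBG : B * G = G * B)
    (hM : (G⁻¹ * B - D⁻¹).PosSemidef) : G.trace ≤ (B * D).trace := by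
  have hGu : IsUnit G.det := (isUnit_iff_isUnit_det _).1 hG.isUnit
  have hDu : IsUnit D.det := (isUnit_iff_isUnit_det _).1 hD.isUnit
  have e1 : (G * D) * (G⁻¹ * B - D⁻¹) = B * D - G := by
    rw [mul_sub, mul_assoc G D D⁻¹, mul_nonsing_inv _ hDu, mul_one, hGD, mul_assoc,
      mul_nonsing_inv_cancel_left _ _ hGu, hBD]
  have e2 : (G⁻¹ * B - D⁻¹) * (G * D) = B * D - G := by
    rw [sub_mul, hGD, nonsing_inv_mul_cancel_left _ _ hDu, ← hGD, mul_assoc, ← mul_assoc B,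
      hBG, mul_assoc, nonsing_inv_mul_cancel_left _ _ hGu]
  have h := aux_comm_psd (aux_comm_psd hG.posSemidef hD.posSemidef hGD) hM (e1.trans e2.symm)
  rw [e1] at h
  have := h.trace_nonneg
  rw [trace_sub] at this
  linarith



/-- Continuous-time case of Corollary 4.6: uniqueness for `X' = F(t, X)` under the
inverse Lipschitz condition `(P - Q)⁻¹ ≤ (F(t,P) - F(t,Q))⁻¹ * B(t)` (in the Loewner
order) for `P - Q` positive definite. -/
theorem stmt_15 (n : ℕ) (hn : 1 ≤ n) (a b : ℝ) (hab : a ≤ b)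
    (S : Set (Matrix (Fin n) (Fin n) ℝ))
    (hS : ∀ P ∈ S, P.IsSymm)
    (F : ℝ → Matrix (Fin n) (Fin n) ℝ → Matrix (Fin n) (Fin n) ℝ)
    (hFsymm : ∀ t ∈ Icc a b, ∀ P ∈ S, (F t P).IsSymm)
    (B : ℝ → Matrix (Fin n) (Fin n) ℝ)
    (hBcont : ContinuousOn B (Icc a b))
    (hBpd : ∀ t ∈ Icc a b, (B t).PosDef)
    (hBB : ∀ s ∈ Icc a b, ∀ t ∈ Icc a b, B s * B t = B t * B s)
    (hBS : ∀ s ∈ Icc a b, ∀ P ∈ S, B s * P = P * B s)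
    (hBF : ∀ s ∈ Icc a b, ∀ t ∈ Icc a b, ∀ Q ∈ S, B s * F t Q = F t Q * B s)
    (hLip : ∀ t ∈ Icc a b, ∀ P ∈ S, ∀ Q ∈ S, (P - Q).PosSemidef →
      P = Q ∨
        ((P - Q).PosDef ∧ (F t P - F t Q).PosDef ∧
          (F t P - F t Q) * (P - Q) = (P - Q) * (F t P - F t Q) ∧
          ((F t P - F t Q)⁻¹ * B t - (P - Q)⁻¹).PosSemidef))
    (X Y : ℝ → Matrix (Fin n) (Fin n) ℝ)
    (hX : ∀ t ∈ Icc a b, ∀ i j, HasDerivAt (fun s => X s i j) (F t (X t) i j) t)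
    (hY : ∀ t ∈ Icc a b, ∀ i j, HasDerivAt (fun s => Y s i j) (F t (Y t) i j) t)
    (hXS : ∀ t ∈ Icc a b, X t ∈ S)
    (hYS : ∀ t ∈ Icc a b, Y t ∈ S)
    (hXY : ∀ t ∈ Icc a b, (X t - Y t).PosSemidef)
    (hinit : X a = Y a) :
    ∀ t ∈ Icc a b, X t = Y t := by
  have hder : ∀ t ∈ Icc a b, HasDerivAt (fun s => (X s - Y s).trace)
      ((F t (X t) - F t (Y t)).trace) t := by
    intro t ht
    simp only [Matrix.trace, Matrix.diag, Matrix.sub_apply]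
    exact HasDerivAt.fun_sum fun i _ => (hX t ht i i).sub (hY t ht i i)
  have hcont : ContinuousOn (fun t => ∑ i, ∑ j, |B t i j|) (Icc a b) := by
    refine continuousOn_finset_sum _ fun i _ => continuousOn_finset_sum _ fun j _ => ?_
    exact ((continuous_apply_apply i j).comp_continuousOn hBcont).abs
  obtain ⟨K, hK⟩ := isCompact_Icc.bddAbove_image hcont
  have hKb : ∀ t ∈ Icc a b, ∑ i, ∑ j, |B t i j| ≤ K := fun t ht => hK ⟨t, ht, rfl⟩
  have hbound : ∀ t ∈ Ico a b, ‖(F t (X t) - F t (Y t)).trace‖ ≤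
      K * ‖(X t - Y t).trace‖ + 0 := by
    intro t ht'
    have ht := Ico_subset_Icc_self ht'
    rcases hLip t ht _ (hXS t ht) _ (hYS t ht) (hXY t ht) with h | ⟨hD, hG, hc, hM⟩
    · simp [h]
    · have hT := (hXY t ht).trace_nonneg
      rw [Real.norm_of_nonneg hG.posSemidef.trace_nonneg, Real.norm_of_nonneg hT, add_zero]
      refine (aux_key hD hG hc ?_ ?_ hM).trans ((aux_trace_mul _ (hXY t ht)).trans
        (mul_le_mul_of_nonneg_right (hKb t ht) hT))
      · rw [mul_sub, sub_mul, hBS t ht _ (hXS t ht), hBS t ht _ (hYS t ht)]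
      · rw [mul_sub, sub_mul, hBF t ht t ht _ (hXS t ht), hBF t ht t ht _ (hYS t ht)]
  intro t ht
  have := norm_le_gronwallBound_of_norm_deriv_right_le (δ := 0)
    (fun s hs => (hder s hs).continuousAt.continuousWithinAt)
    (fun s hs => (hder s (Ico_subset_Icc_self hs)).hasDerivWithinAt)
    (by simp [hinit]) hbound t ht
  rw [gronwallBound_ε0_δ0, norm_le_zero_iff] at this
  exact sub_eq_zero.1 ((hXY t ht).trace_eq_zero_iff.1 this)
end
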